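/- arXiv:2305.07914 — 2 statements merged into one kernel-verified Lean document; each statement's English description precedes it below -/
import Mathlib

section
/- (Entropic uncertainty relation for interactive measurements, single-intervention case.) Let T = {T_x}_{x=1}^m and S = {S_y}_{y=1}^m be two testers with roulette vector w. Then for every process comb J, the outcome distributions p_x := Tr[J T_x] and q_y := Tr[J S_y] satisfy H(p) + H(q) ≥ 2H(w) − 2, where the right-hand side is independent of J. -/
open Matrix BigOperators ComplexOrder

noncomputable section

/-- Index type for the three systems A, B, C. -/
abbrev PIdx (dA dB dC : ℕ) := Fin dA × Fin dB × Fin dC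

/-- Matrices on `ℂ^{dA} ⊗ ℂ^{dB} ⊗ ℂ^{dC}`. -/
abbrev PMat (dA dB dC : ℕ) := Matrix (PIdx dA dB dC) (PIdx dA dB dC) ℂ

/-- Partial trace over the third (C) tensor factor. -/
def trC {dA dB dC : ℕ} (M : PMat dA dB dC) :
    Matrix (Fin dA × Fin dB) (Fin dA × Fin dB) ℂ :=
  Matrix.of fun i j => ∑ c : Fin dC, M (i.1, i.2, c) (j.1, j.2, c)

/-- Partial trace over the second tensor factor of a bipartite matrix. -/
def trSnd {d₁ d₂ : ℕ} (M : Matrix (Fin d₁ × Fin d₂) (Fin d₁ × Fin d₂) ℂ) :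
    Matrix (Fin d₁) (Fin d₁) ℂ :=
  Matrix.of fun a a' => ∑ b : Fin d₂, M (a, b) (a', b)

/-- A process comb: a PSD matrix `J` on A ⊗ B ⊗ C with `Tr_C J = ρ_A ⊗ I_B`
for some state `ρ_A`. -/
def IsProcessComb {dA dB dC : ℕ} (J : PMat dA dB dC) : Prop :=
  J.PosSemidef ∧ ∃ ρ : Matrix (Fin dA) (Fin dA) ℂ,
    ρ.PosSemidef ∧ ρ.trace = 1 ∧
    trC J = Matrix.of fun i j => ρ i.1 j.1 * (if i.2 = j.2 then (1 : ℂ) else 0)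

/-- A tester with `m` outcomes: PSD matrices `T x` with `∑ x, T x = Λ ⊗ I_C`
for some PSD `Λ` on A ⊗ B with `Tr_B Λ = I_A`. -/
def IsTester {dA dB dC m : ℕ} (T : Fin m → PMat dA dB dC) : Prop :=
  (∀ x, (T x).PosSemidef) ∧
  ∃ Λ : Matrix (Fin dA × Fin dB) (Fin dA × Fin dB) ℂ,
    Λ.PosSemidef ∧ trSnd Λ = 1 ∧
    (∑ x, T x) = Matrix.of fun i j =>
      Λ (i.1, i.2.1) (j.1, j.2.1) * (if i.2.2 = j.2.2 then (1 : ℂ) else 0)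

/-- Outcome probability `Tr[J T]` (as a real number). -/
def prob {dA dB dC : ℕ} (J T : PMat dA dB dC) : ℝ := ((J * T).trace).re

/-- `P_k`: Bob's optimal winning probability in the quantum roulette with `k` chips,
for the pair of testers `T`, `S`. -/
def rouletteP {dA dB dC m : ℕ} (T S : Fin m → PMat dA dB dC) (k : ℕ) : ℝ :=
  sSup { r : ℝ | ∃ J : PMat dA dB dC, IsProcessComb J ∧
    ∃ G : Finset (Fin 2 × Fin m), G.card = k ∧
      r = ∑ g ∈ G, (1 / 2 : ℝ) * prob J (if g.1 = 0 then T g.2 else S g.2) }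

/-- The roulette vector `w ∈ ℝ^{2m}`, `w_k = P_k - P_{k-1}`. -/
def rouletteW {dA dB dC m : ℕ} (T S : Fin m → PMat dA dB dC) : Fin (m + m) → ℝ :=
  fun k => rouletteP T S (k.1 + 1) - rouletteP T S k.1

/-- Sum of the `k` largest entries of a (nonnegative) vector, padding with zeros. -/
def kMaxSum {n : ℕ} (u : Fin n → ℝ) (k : ℕ) : ℝ :=
  sSup { r : ℝ | ∃ A : Finset (Fin n), A.card = min k n ∧ r = ∑ i ∈ A, u i }

/-- `MajorizedBy u v` means `u ≺ v`: every partial sum of the `k` largest entries of `u`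
is at most that of `v`, and the total sums agree. -/
def MajorizedBy {m n : ℕ} (u : Fin m → ℝ) (v : Fin n → ℝ) : Prop :=
  (∀ k : ℕ, kMaxSum u k ≤ kMaxSum v k) ∧ ∑ i, u i = ∑ i, v i

/-- Base-2 Shannon entropy of a finite vector. -/
def H2 {n : ℕ} (p : Fin n → ℝ) : ℝ := -∑ i, p i * Real.logb 2 (p i)

theorem sum_range_mul_nonneg_of_antitone {g d : ℕ → ℝ} (hg : Antitone g) {n : ℕ}
    (hd : ∀ k ≤ n, 0 ≤ ∑ i ∈ Finset.range k, d i) (hn : ∑ i ∈ Finset.range n, d i = 0) :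
    0 ≤ ∑ i ∈ Finset.range n, g i * d i := by
  have key : ∀ k ≤ n, g k * ∑ i ∈ Finset.range k, d i ≤ ∑ i ∈ Finset.range k, g i * d i := by
    intro k
    induction k with
    | zero => simp
    | succ k ih =>
      intro hk
      have h₁ := ih (by omega)
      have h₂ := mul_le_mul_of_nonneg_right (hg k.le_succ) (hd (k + 1) hk)
      rw [Finset.sum_range_succ] at h₂ ⊢
      rw [Finset.sum_range_succ]
      simp only [Nat.succ_eq_add_one] at h₂
      linarith
  simpa [hn] using key n le_rfl

theorem mul_log_sub_le_mul_log {x y : ℝ} (hx : 0 < x) (hy : 0 < y) :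
    (Real.log x + 1) * (y - x) ≤ y * Real.log y - x * Real.log x := by
  have h := mul_le_mul_of_nonneg_left (Real.log_le_sub_one_of_pos (div_pos hx hy)) hy.le
  rw [Real.log_div hx.ne' hy.ne'] at h
  have : y * (x / y - 1) = x - y := by field_simp
  linarith

theorem sum_range_negMulLog_le {u w : ℕ → ℝ} {n : ℕ} (hu : Antitone u)
    (hu₀ : ∀ i, 0 ≤ u i) (hw₀ : ∀ i < n, 0 ≤ w i)
    (huw : ∀ k ≤ n, ∑ i ∈ Finset.range k, u i ≤ ∑ i ∈ Finset.range k, w i)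
    (hn : ∑ i ∈ Finset.range n, u i = ∑ i ∈ Finset.range n, w i) :
    ∑ i ∈ Finset.range n, Real.negMulLog (w i) ≤ ∑ i ∈ Finset.range n, Real.negMulLog (u i) := by
  have shifted : ∀ ε : ℝ, 0 < ε → ∑ i ∈ Finset.range n, Real.negMulLog (w i + ε)
      ≤ ∑ i ∈ Finset.range n, Real.negMulLog (u i + ε) := by
    intro ε hε
    have hlog : Antitone fun i => Real.log (u i + ε) + 1 := by
      intro i j hij
      have := hu hij
      have := hu₀ j
      have := Real.log_le_log (by linarith : 0 < u j + ε) (by linarith : u j + ε ≤ u i + ε)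
      simpa using this
    have h := sum_range_mul_nonneg_of_antitone (d := fun i => w i - u i) hlog (n := n)
      (fun k hk => by simpa using huw k hk) (by simp [hn])
    rw [← sub_nonneg, ← Finset.sum_sub_distrib]
    refine h.trans (Finset.sum_le_sum fun i hi => ?_)
    have := mul_log_sub_le_mul_log (by linarith [hu₀ i] : 0 < u i + ε)
      (by linarith [hw₀ i (Finset.mem_range.mp hi)] : 0 < w i + ε)
    simp only [Real.negMulLog]
    linarith
  have tend : ∀ v : ℕ → ℝ, Filter.Tendsto
      (fun ε : ℝ => ∑ i ∈ Finset.range n, Real.negMulLog (v i + ε))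
      (nhdsWithin 0 (Set.Ioi 0)) (nhds (∑ i ∈ Finset.range n, Real.negMulLog (v i))) := by
    intro v
    have hc : Continuous fun ε : ℝ => ∑ i ∈ Finset.range n, Real.negMulLog (v i + ε) :=
      continuous_finsetSum _ fun i _ =>
        Real.continuous_negMulLog.comp (continuous_const.add continuous_id)
    simpa using (hc.tendsto 0).mono_left nhdsWithin_le_nhds
  exact le_of_tendsto_of_tendsto (tend w) (tend u)
    (Filter.eventually_of_mem self_mem_nhdsWithin shifted)

theorem exists_equiv_fin_antitone {ι : Type*} [Fintype ι] {n : ℕ} (hn : Fintype.card ι = n)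
    (u : ι → ℝ) : ∃ e : Fin n ≃ ι, Antitone (u ∘ e) := by
  let e := (Fintype.equivFinOfCardEq hn).symm
  refine ⟨(Tuple.sort fun i => -u (e i)).trans e, fun i j hij => ?_⟩
  have := Tuple.monotone_sort (fun i => -u (e i)) hij
  simpa using this

/-- Schur concavity of entropy, for a dominating sequence that need not be sorted. -/
theorem sum_negMulLog_le_of_finset_sum_le {ι : Type*} [Fintype ι] {n : ℕ}
    (hn : Fintype.card ι = n) {u : ι → ℝ} {w : ℕ → ℝ} (hu₀ : ∀ i, 0 ≤ u i)
    (hw₀ : ∀ i < n, 0 ≤ w i)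
    (huw : ∀ A : Finset ι, ∑ i ∈ A, u i ≤ ∑ i ∈ Finset.range A.card, w i)
    (htot : ∑ i, u i = ∑ i ∈ Finset.range n, w i) :
    ∑ i ∈ Finset.range n, Real.negMulLog (w i) ≤ ∑ i, Real.negMulLog (u i) := by
  obtain ⟨e, he⟩ := exists_equiv_fin_antitone hn u
  let v : ℕ → ℝ := fun k => if h : k < n then u (e ⟨k, h⟩) else 0
  have hv : ∀ k : Fin n, v k = u (e k) := fun k => by simp [v]
  have hv₀ : ∀ k, 0 ≤ v k := by
    intro k
    by_cases h : k < n <;> simp [v, h, hu₀]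
  have hanti : Antitone v := by
    intro i j hij
    by_cases hj : j < n
    · have hi : i < n := hij.trans_lt hj
      have := he (show (⟨i, hi⟩ : Fin n) ≤ ⟨j, hj⟩ from hij)
      simpa [v, hi, hj] using this
    · simpa [v, hj] using hv₀ i
  have hsum : ∀ f : ℝ → ℝ, ∑ i ∈ Finset.range n, f (v i) = ∑ i, f (u i) := by
    intro f
    rw [Finset.sum_range, ← e.sum_comp fun i => f (u i)]
    simp only [hv]
  rw [← hsum]
  refine sum_range_negMulLog_le hanti hv₀ hw₀ (fun k hk => ?_) ((hsum id).trans htot)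
  have h := huw ((Finset.univ : Finset (Fin k)).map ((Fin.castLEEmb hk).trans e.toEmbedding))
  rw [Finset.card_map, Finset.card_univ, Fintype.card_fin, Finset.sum_map] at h
  refine le_of_eq_of_le ?_ h
  rw [Finset.sum_range]
  exact Finset.sum_congr rfl fun i _ => hv (Fin.castLE hk i)

theorem prob_nonneg {dA dB dC : ℕ} {J T : PMat dA dB dC} (hJ : J.PosSemidef)
    (hT : T.PosSemidef) : 0 ≤ prob J T := by
  obtain ⟨r, v, rfl⟩ := Matrix.posSemidef_iff_eq_sum_vecMulVec.mp hT
  simp only [prob, Matrix.mul_sum, Matrix.trace_sum, Complex.re_sum]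
  refine Finset.sum_nonneg fun i _ => ?_
  rw [Matrix.mul_vecMulVec, Matrix.trace_vecMulVec, dotProduct_comm]
  exact (Complex.nonneg_iff.mp (hJ.dotProduct_mulVec_nonneg (v i))).1

theorem trace_mul_kronecker_one_eq {dA dB dC : ℕ} (J : PMat dA dB dC)
    (Λ : Matrix (Fin dA × Fin dB) (Fin dA × Fin dB) ℂ) :
    (J * Matrix.of fun i j : PIdx dA dB dC =>
      Λ (i.1, i.2.1) (j.1, j.2.1) * (if i.2.2 = j.2.2 then (1 : ℂ) else 0)).trace
      = (trC J * Λ).trace := by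
  simp only [Matrix.trace, Matrix.diag, Matrix.mul_apply, trC, Matrix.of_apply,
    Fintype.sum_prod_type, mul_ite, mul_one, mul_zero, Finset.sum_mul,
    Finset.sum_ite_eq', Finset.mem_univ, if_true]
  refine Finset.sum_congr rfl fun a _ => Finset.sum_congr rfl fun b _ => ?_
  rw [Finset.sum_comm]
  refine Finset.sum_congr rfl fun a' _ => ?_
  rw [Finset.sum_comm]

theorem sum_prob_eq_one {dA dB dC m : ℕ} {J : PMat dA dB dC} {T : Fin m → PMat dA dB dC}
    (hJ : IsProcessComb J) (hT : IsTester T) : ∑ x, prob J (T x) = 1 := by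
  obtain ⟨-, ρ, -, hρ, hJρ⟩ := hJ
  obtain ⟨-, Λ, -, hΛ, hTΛ⟩ := hT
  have htr : (trC J * Λ).trace = (ρ * trSnd Λ).trace := by
    simp only [hJρ, Matrix.trace, Matrix.diag, Matrix.mul_apply, trSnd, Matrix.of_apply,
      Fintype.sum_prod_type, mul_ite, mul_one, mul_zero, ite_mul, zero_mul, Finset.sum_ite_eq,
      Finset.mem_univ, if_true, Finset.mul_sum]
    refine Finset.sum_congr rfl fun a _ => ?_
    rw [Finset.sum_comm]
  simp only [prob]
  rw [← Complex.re_sum, ← Matrix.trace_sum, ← Matrix.mul_sum, hTΛ, trace_mul_kronecker_one_eq,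
    htr, hΛ, mul_one, hρ, Complex.one_re]

/-- The outcome distribution of the roulette on `J`, over all pairs of a tester and an outcome. -/
def rouletteDist {dA dB dC m : ℕ} (T S : Fin m → PMat dA dB dC) (J : PMat dA dB dC)
    (g : Fin 2 × Fin m) : ℝ :=
  (1 / 2 : ℝ) * prob J (if g.1 = 0 then T g.2 else S g.2)

section Roulette

variable {dA dB dC m : ℕ} {T S : Fin m → PMat dA dB dC} {J : PMat dA dB dC}

theorem rouletteDist_nonneg (hT : IsTester T) (hS : IsTester S) (hJ : IsProcessComb J)
    (g : Fin 2 × Fin m) : 0 ≤ rouletteDist T S J g := by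
  refine mul_nonneg (by norm_num) (prob_nonneg hJ.1 ?_)
  split_ifs
  exacts [hT.1 _, hS.1 _]

theorem sum_comp_rouletteDist (f : ℝ → ℝ) :
    ∑ g, f (rouletteDist T S J g)
      = ∑ x, f (1 / 2 * prob J (T x)) + ∑ y, f (1 / 2 * prob J (S y)) := by
  simp [Fintype.sum_prod_type, Fin.sum_univ_two, rouletteDist]

theorem sum_rouletteDist (hT : IsTester T) (hS : IsTester S) (hJ : IsProcessComb J) :
    ∑ g, rouletteDist T S J g = 1 := by
  refine (sum_comp_rouletteDist id).trans ?_
  simp only [id, ← Finset.mul_sum, sum_prob_eq_one hJ hT, sum_prob_eq_one hJ hS]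
  norm_num

theorem finset_sum_rouletteDist_le_one (hT : IsTester T) (hS : IsTester S)
    (hJ : IsProcessComb J) (G : Finset (Fin 2 × Fin m)) :
    ∑ g ∈ G, rouletteDist T S J g ≤ 1 :=
  (Finset.sum_le_univ_sum_of_nonneg (rouletteDist_nonneg hT hS hJ)).trans_eq
    (sum_rouletteDist hT hS hJ)

theorem sum_rouletteDist_le_rouletteP (hT : IsTester T) (hS : IsTester S)
    (hJ : IsProcessComb J) (G : Finset (Fin 2 × Fin m)) :
    ∑ g ∈ G, rouletteDist T S J g ≤ rouletteP T S G.card := by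
  refine le_csSup ⟨1, ?_⟩ ⟨J, hJ, G, rfl, rfl⟩
  rintro r ⟨J', hJ', G', -, rfl⟩
  exact finset_sum_rouletteDist_le_one hT hS hJ' G'

theorem rouletteP_le (hJ : IsProcessComb J) {k : ℕ} (hk : k ≤ m + m) {b : ℝ}
    (hb : ∀ J' : PMat dA dB dC, IsProcessComb J' → ∀ G : Finset (Fin 2 × Fin m), G.card = k →
      ∑ g ∈ G, rouletteDist T S J' g ≤ b) : rouletteP T S k ≤ b := by
  obtain ⟨G, hG⟩ := Finset.exists_subset_card_eq
    (s := (Finset.univ : Finset (Fin 2 × Fin m))) (n := k) (by simp; omega)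
  refine csSup_le ⟨_, J, hJ, G, hG.2, rfl⟩ ?_
  rintro r ⟨J', hJ', G', hG', rfl⟩
  exact hb J' hJ' G' hG'

theorem rouletteP_zero (hT : IsTester T) (hS : IsTester S) (hJ : IsProcessComb J) :
    rouletteP T S 0 = 0 := by
  refine le_antisymm (rouletteP_le hJ (Nat.zero_le _) fun J' _ G hG => ?_) ?_
  · simp [Finset.card_eq_zero.mp hG]
  · simpa using sum_rouletteDist_le_rouletteP hT hS hJ ∅

theorem rouletteP_two_mul (hT : IsTester T) (hS : IsTester S) (hJ : IsProcessComb J) :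
    rouletteP T S (m + m) = 1 := by
  refine le_antisymm (rouletteP_le hJ le_rfl fun J' hJ' G _ =>
    finset_sum_rouletteDist_le_one hT hS hJ' G) ?_
  have h := sum_rouletteDist_le_rouletteP hT hS hJ Finset.univ
  rwa [sum_rouletteDist hT hS hJ, Finset.card_univ, Fintype.card_prod, Fintype.card_fin,
    Fintype.card_fin, two_mul] at h

theorem rouletteP_le_succ (hT : IsTester T) (hS : IsTester S) (hJ : IsProcessComb J) {k : ℕ}
    (hk : k < m + m) : rouletteP T S k ≤ rouletteP T S (k + 1) := by
  refine rouletteP_le hJ hk.le fun J' hJ' G hG => ?_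
  obtain ⟨G', hGG', -, hG'⟩ := Finset.exists_subsuperset_card_eq G.subset_univ
    (n := k + 1) (by omega) (by simp; omega)
  rw [← hG']
  exact (Finset.sum_le_sum_of_subset_of_nonneg hGG' fun g _ _ =>
    rouletteDist_nonneg hT hS hJ' g).trans (sum_rouletteDist_le_rouletteP hT hS hJ' G')

theorem sum_negMulLog_rouletteW_le (hT : IsTester T) (hS : IsTester S)
    (hJ : IsProcessComb J) :
    ∑ k, Real.negMulLog (rouletteW T S k) ≤ ∑ g, Real.negMulLog (rouletteDist T S J g) := by
  have h := sum_negMulLog_le_of_finset_sum_le (n := m + m) (u := rouletteDist T S J)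
    (w := fun k => rouletteP T S (k + 1) - rouletteP T S k) (by simp [two_mul])
    (rouletteDist_nonneg hT hS hJ)
    (fun k hk => sub_nonneg.mpr (rouletteP_le_succ hT hS hJ hk))
    (fun A => by
      rw [Finset.sum_range_sub, rouletteP_zero hT hS hJ, sub_zero]
      exact sum_rouletteDist_le_rouletteP hT hS hJ A)
    (by rw [Finset.sum_range_sub, rouletteP_zero hT hS hJ, sub_zero,
      rouletteP_two_mul hT hS hJ, sum_rouletteDist hT hS hJ])
  rwa [Finset.sum_range] at h

end Roulette

theorem H2_eq_sum_negMulLog {n : ℕ} (p : Fin n → ℝ) :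
    H2 p = (∑ i, Real.negMulLog (p i)) / Real.log 2 := by
  simp only [H2, Real.negMulLog, Real.logb, Finset.sum_div, ← Finset.sum_neg_distrib]
  exact Finset.sum_congr rfl fun i _ => by ring

theorem sum_negMulLog_half_mul {n : ℕ} {p : Fin n → ℝ} (hp : ∑ i, p i = 1) :
    ∑ i, Real.negMulLog (1 / 2 * p i) = (∑ i, Real.negMulLog (p i)) / 2 + Real.log 2 / 2 := by
  have hhalf : Real.negMulLog (1 / 2) = Real.log 2 / 2 := by
    rw [Real.negMulLog, one_div, Real.log_inv]
    ring
  simp only [Real.negMulLog_mul, Finset.sum_add_distrib, ← Finset.sum_mul, ← Finset.mul_sum, hp,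
    hhalf]
  ring

/-- entropic uncertainty relation for interactive measurements,
single-intervention case: for any two testers with roulette vector `w` and every
process comb `J`, `H(p) + H(q) ≥ 2H(w) - 2`, the bound being independent of `J`. -/
theorem entropic_uncertainty_relation_interactive
    {dA dB dC m : ℕ} (hA : 0 < dA) (hB : 0 < dB) (hC : 0 < dC)
    (T S : Fin m → PMat dA dB dC) (hT : IsTester T) (hS : IsTester S)
    (J : PMat dA dB dC) (hJ : IsProcessComb J) :
    2 * H2 (rouletteW T S) - 2
      ≤ H2 (fun x => prob J (T x)) + H2 (fun y => prob J (S y)) := by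
  have hlog : 0 < Real.log 2 := Real.log_pos one_lt_two
  have h := sum_negMulLog_rouletteW_le hT hS hJ
  rw [sum_comp_rouletteDist, sum_negMulLog_half_mul (sum_prob_eq_one hJ hT),
    sum_negMulLog_half_mul (sum_prob_eq_one hJ hS)] at h
  rw [H2_eq_sum_negMulLog, H2_eq_sum_negMulLog, H2_eq_sum_negMulLog, ← add_div, mul_div_assoc',
    sub_le_iff_le_add, div_le_iff₀ hlog, add_mul, div_mul_cancel₀ _ hlog.ne']
  linarith
end
end

section
/- (Causal uncertainty relation.) Let d ≥ 2 and let all three systems A, B, C be ℂ^d. For every process comb J, every choice of unitaries U₁, U₂, U₃, U₄ on ℂ^d, and every maximally entangled orthonormal basis {|Φ_i⟩}_{i=1}^{d²}, the common-cause indicator distribution p and the direct-cause indicator distribution q of J satisfy H(p) + H(q) ≥ 2 log₂ d. -/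
open Matrix BigOperators ComplexOrder

noncomputable section

/-- Rank-one projector `|φ⟩⟨φ|` on a bipartite system. -/
def projMat {d : ℕ} (φ : Fin d × Fin d → ℂ) :
    Matrix (Fin d × Fin d) (Fin d × Fin d) ℂ :=
  Matrix.of fun x y => φ x * (starRingEnd ℂ) (φ y)

/-- Embed an operator on A ⊗ C as an operator on A ⊗ B ⊗ C acting as the identity on B. -/
def embAC {d : ℕ} (M : Matrix (Fin d × Fin d) (Fin d × Fin d) ℂ) : PMat d d d :=
  Matrix.of fun i j => M (i.1, i.2.2) (j.1, j.2.2) * (if i.2.1 = j.2.1 then (1 : ℂ) else 0)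

/-- Embed an operator on B ⊗ C as an operator on A ⊗ B ⊗ C acting as the identity on A. -/
def embBC {d : ℕ} (M : Matrix (Fin d × Fin d) (Fin d × Fin d) ℂ) : PMat d d d :=
  Matrix.of fun i j => M (i.2.1, i.2.2) (j.2.1, j.2.2) * (if i.1 = j.1 then (1 : ℂ) else 0)

/-- `(U ⊗ V) |φ⟩` for a bipartite vector `φ`. -/
def kronVec {d : ℕ} (U V : Matrix (Fin d) (Fin d) ℂ) (φ : Fin d × Fin d → ℂ) :
    Fin d × Fin d → ℂ :=
  fun x => ∑ y : Fin d × Fin d, U x.1 y.1 * V x.2 y.2 * φ y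

/-- An orthonormal basis `{Φ_i}` of `ℂ^d ⊗ ℂ^d` consisting of maximally entangled vectors,
with `Φ_1 = (1/√d) ∑_k |kk⟩`. -/
def IsMaxEntBasis {d : ℕ} (Φ : Fin (d * d) → Fin d × Fin d → ℂ) : Prop :=
  (∀ i j, ∑ x : Fin d × Fin d, (starRingEnd ℂ) (Φ i x) * Φ j x
      = if i = j then (1 : ℂ) else 0) ∧
  (∀ i a a', ∑ b : Fin d, Φ i (a, b) * (starRingEnd ℂ) (Φ i (a', b))
      = if a = a' then (1 : ℂ) / d else 0) ∧
  (∀ i b b', ∑ a : Fin d, Φ i (a, b) * (starRingEnd ℂ) (Φ i (a, b'))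
      = if b = b' then (1 : ℂ) / d else 0) ∧
  ∀ (h : 0 < d * d) (x : Fin d × Fin d),
    Φ ⟨0, h⟩ x = if x.1 = x.2 then ((1 / Real.sqrt d : ℝ) : ℂ) else 0

/-- Outcome distribution of the common-cause indicator `T_CC(U₁, U₂)` on a process comb:
`p_i = (1/d) Tr[J ((U₁⊗U₂)|Φ_i⟩⟨Φ_i|(U₁⊗U₂)†)_{AC} ⊗ I_B]`. -/
def ccProb {d : ℕ} (U₁ U₂ : Matrix (Fin d) (Fin d) ℂ)
    (Φ : Fin (d * d) → Fin d × Fin d → ℂ) (J : PMat d d d) : Fin (d * d) → ℝ :=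
  fun i => (1 / d) * prob J (embAC (projMat (kronVec U₁ U₂ (Φ i))))

/-- Outcome distribution of the direct-cause indicator `T_DC(U₃, U₄)` on a process comb:
`q_i = (1/d) Tr[J (I_A ⊗ ((U₃⊗U₄)|Φ_i⟩⟨Φ_i|(U₃⊗U₄)†)_{BC})]`. -/
def dcProb {d : ℕ} (U₃ U₄ : Matrix (Fin d) (Fin d) ℂ)
    (Φ : Fin (d * d) → Fin d × Fin d → ℂ) (J : PMat d d d) : Fin (d * d) → ℝ :=
  fun i => (1 / d) * prob J (embBC (projMat (kronVec U₃ U₄ (Φ i))))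

open Complex in
/-- Differentiating the three-lines inequality `‖F x‖ ≤ c ^ x` for an exponential sum at `0`. -/
lemma sum_mul_re_le_log_of_three_lines {ι : Type*} [Fintype ι] (L : ι → ℝ) (m : ι → ℂ) {c : ℝ}
    (hc : 0 < c) (hm : ∑ i, m i = 1)
    (h0 : ∀ z : ℂ, z.re = 0 → ‖∑ i, cexp (z * L i) * m i‖ ≤ 1)
    (h1 : ∀ z : ℂ, z.re = 1 → ‖∑ i, cexp (z * L i) * m i‖ ≤ c) :
    ∑ i, L i * (m i).re ≤ Real.log c := by
  have hstrip : ∀ x : ℝ, 0 ≤ x → x ≤ 1 → ‖∑ i, cexp (x * L i) * m i‖ ≤ c ^ x := by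
    intro x hx0 hx1
    have hd : Differentiable ℂ fun z : ℂ => ∑ i, cexp (z * L i) * m i := by fun_prop
    have key := HadamardThreeLines.norm_le_interp_of_mem_verticalClosedStrip₀₁'
      (fun z : ℂ => ∑ i, cexp (z * L i) * m i) (z := (x : ℂ)) (a := 1) (b := c)
      (by simp [HadamardThreeLines.verticalClosedStrip, hx0, hx1]) hd.diffContOnCl ?_ h0 h1
    · simpa using key
    · refine ⟨∑ i, Real.exp |L i| * ‖m i‖, ?_⟩
      rintro _ ⟨z, hz, rfl⟩
      obtain ⟨hz0, hz1⟩ : 0 ≤ z.re ∧ z.re ≤ 1 := hz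
      refine (norm_sum_le _ _).trans (Finset.sum_le_sum fun i _ => ?_)
      rw [norm_mul, norm_exp, re_mul_ofReal]
      gcongr
      calc z.re * L i ≤ z.re * |L i| := by gcongr; exact le_abs_self _
        _ ≤ 1 * |L i| := by gcongr
        _ = |L i| := one_mul _
  have hderiv : HasDerivAt (fun x : ℝ => c ^ x - ∑ i, Real.exp (x * L i) * (m i).re)
      (Real.log c - ∑ i, L i * (m i).re) 0 := by
    have e1 : HasDerivAt (fun x : ℝ => c ^ x) (Real.log c) 0 := by
      simpa using (hasDerivAt_id (0 : ℝ)).const_rpow hc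
    refine e1.sub (HasDerivAt.fun_sum fun i _ => ?_)
    simpa using (((hasDerivAt_id (0 : ℝ)).mul_const (L i)).exp).mul_const (m i).re
  have hlim := hderiv.tendsto_slope_zero_right
  refine sub_nonneg.1 (ge_of_tendsto hlim ?_)
  filter_upwards [Ioo_mem_nhdsGT (zero_lt_one' ℝ)] with t ht
  have hre : ∑ i, (m i).re = 1 := by rw [← re_sum, hm, one_re]
  have hle : ∑ i, Real.exp (t * L i) * (m i).re ≤ c ^ t := by
    refine le_trans (le_of_eq ?_) ((re_le_norm _).trans (hstrip t ht.1.le ht.2.le))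
    rw [re_sum]
    refine Finset.sum_congr rfl fun i _ => ?_
    rw [← ofReal_mul, ← ofReal_exp, re_ofReal_mul]
  simp only [zero_add, smul_eq_mul, Real.rpow_zero, zero_mul, Real.exp_zero, one_mul, hre, sub_self,
    sub_zero]
  exact mul_nonneg (inv_nonneg.2 ht.1.le) (sub_nonneg.2 hle)

section MaassenUffink

variable {E ι κ : Type*} [SeminormedAddCommGroup E] [InnerProductSpace ℂ E] [Fintype ι] [Fintype κ]

lemma norm_sum_smul_sq_of_orthogonal {a : ι → E} (ha : ∀ i j, i ≠ j → inner ℂ (a i) (a j) = 0)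
    (w : ι → ℂ) : ‖∑ i, w i • a i‖ ^ 2 = ∑ i, ‖w i‖ ^ 2 * ‖a i‖ ^ 2 := by
  classical
  rw [← inner_self_eq_norm_sq (𝕜 := ℂ), sum_inner, map_sum]
  refine Finset.sum_congr rfl fun i _ => ?_
  rw [inner_sum, Finset.sum_eq_single i, inner_self_eq_norm_sq, norm_smul, mul_pow]
  · intro j _ hj
    rw [inner_smul_left, inner_smul_right, ha i j hj.symm, mul_zero, mul_zero]
  · simp

open Complex in
/-- The Maassen–Uffink inequality for two orthogonal decompositions of a unit vector. -/
theorem maassen_uffink {a : ι → E} {b : κ → E} {ψ : E} {c : ℝ} (hc : 0 < c)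
    (ha : ∀ i j, i ≠ j → inner ℂ (a i) (a j) = 0) (hb : ∀ i j, i ≠ j → inner ℂ (b i) (b j) = 0)
    (hsa : ∑ i, a i = ψ) (hsb : ∑ j, b j = ψ) (hψ : ‖ψ‖ = 1)
    (hab : ∀ i j, ‖inner ℂ (a i) (b j)‖ ≤ c * ‖a i‖ * ‖b j‖) :
    ∑ i, ‖a i‖ ^ 2 * Real.log ‖a i‖ + ∑ j, ‖b j‖ ^ 2 * Real.log ‖b j‖ ≤ Real.log c := by
  have hna : ∑ i, ‖a i‖ ^ 2 = 1 := by
    simpa [hsa, hψ] using (norm_sum_smul_sq_of_orthogonal ha fun _ => 1).symm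
  have hnb : ∑ j, ‖b j‖ ^ 2 = 1 := by
    simpa [hsb, hψ] using (norm_sum_smul_sq_of_orthogonal hb fun _ => 1).symm
  have hrow : ∀ i, ∑ j, inner ℂ (a i) (b j) = (‖a i‖ ^ 2 : ℂ) := by
    classical
    intro i
    rw [← inner_sum, hsb, ← hsa, inner_sum, Finset.sum_eq_single i, inner_self_eq_norm_sq_to_K]
    · simp
    · exact fun j _ hj => ha i j hj.symm
    · simp
  have hcol : ∀ j, ∑ i, inner ℂ (a i) (b j) = (‖b j‖ ^ 2 : ℂ) := by
    classical
    intro j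
    rw [← sum_inner, hsa, ← hsb, sum_inner, Finset.sum_eq_single j, inner_self_eq_norm_sq_to_K]
    · simp
    · exact fun i _ hi => hb i j hi
    · simp
  have key := sum_mul_re_le_log_of_three_lines
    (fun x : ι × κ => Real.log ‖a x.1‖ + Real.log ‖b x.2‖)
    (fun x => inner ℂ (a x.1) (b x.2)) hc ?_ ?_ ?_
  · refine le_trans (le_of_eq ?_) key
    have hrow' : ∀ i, ∑ j, (inner ℂ (a i) (b j)).re = ‖a i‖ ^ 2 := fun i => by
      rw [← re_sum, hrow, ← ofReal_pow, ofReal_re]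
    have hcol' : ∀ j, ∑ i, (inner ℂ (a i) (b j)).re = ‖b j‖ ^ 2 := fun j => by
      rw [← re_sum, hcol, ← ofReal_pow, ofReal_re]
    simp only [add_mul, Finset.sum_add_distrib]
    congr 1
    · rw [Fintype.sum_prod_type]
      exact Finset.sum_congr rfl fun i _ => by
        dsimp only
        rw [← Finset.mul_sum, hrow', mul_comm]
    · rw [Fintype.sum_prod_type_right]
      exact Finset.sum_congr rfl fun j _ => by
        dsimp only
        rw [← Finset.mul_sum, hcol', mul_comm]
  · rw [Fintype.sum_prod_type]
    simp only [hrow]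
    exact_mod_cast hna
  · intro z hz
    have hF : ∑ x : ι × κ, cexp (z * ((Real.log ‖a x.1‖ + Real.log ‖b x.2‖ : ℝ) : ℂ)) *
          inner ℂ (a x.1) (b x.2) =
        inner ℂ (∑ i, (starRingEnd ℂ) (cexp (z * Real.log ‖a i‖)) • a i)
          (∑ j, cexp (z * Real.log ‖b j‖) • b j) := by
      rw [Fintype.sum_prod_type, sum_inner]
      refine Finset.sum_congr rfl fun i _ => ?_
      rw [inner_sum]
      refine Finset.sum_congr rfl fun j _ => ?_
      rw [inner_smul_left, inner_smul_right, conj_conj, ofReal_add, mul_add, Complex.exp_add,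
        mul_assoc]
    have hu : ‖∑ i, (starRingEnd ℂ) (cexp (z * Real.log ‖a i‖)) • a i‖ = 1 := by
      rw [← pow_left_inj₀ (norm_nonneg _) zero_le_one two_ne_zero,
        norm_sum_smul_sq_of_orthogonal ha, one_pow, ← hna]
      simp [norm_exp, hz]
    have hv : ‖∑ j, cexp (z * Real.log ‖b j‖) • b j‖ = 1 := by
      rw [← pow_left_inj₀ (norm_nonneg _) zero_le_one two_ne_zero,
        norm_sum_smul_sq_of_orthogonal hb, one_pow, ← hnb]
      simp [norm_exp, hz]
    rw [hF]
    simpa [hu, hv] using norm_inner_le_norm (𝕜 := ℂ)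
      (∑ i, (starRingEnd ℂ) (cexp (z * Real.log ‖a i‖)) • a i)
      (∑ j, cexp (z * Real.log ‖b j‖) • b j)
  · intro z hz
    have hterm : ∀ i j, ‖cexp (z * ((Real.log ‖a i‖ + Real.log ‖b j‖ : ℝ) : ℂ)) *
        inner ℂ (a i) (b j)‖ ≤ c * (‖a i‖ ^ 2 * ‖b j‖ ^ 2) := by
      intro i j
      rw [norm_mul, norm_exp, re_mul_ofReal, hz, one_mul]
      rcases (norm_nonneg (a i)).eq_or_lt with hi | hi
      · have := hab i j
        rw [← hi, mul_zero, zero_mul] at this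
        rw [le_antisymm this (norm_nonneg _), mul_zero]
        positivity
      rcases (norm_nonneg (b j)).eq_or_lt with hj | hj
      · have := hab i j
        rw [← hj, mul_zero] at this
        rw [le_antisymm this (norm_nonneg _), mul_zero]
        positivity
      rw [Real.exp_add, Real.exp_log hi, Real.exp_log hj]
      calc ‖a i‖ * ‖b j‖ * ‖inner ℂ (a i) (b j)‖
          ≤ ‖a i‖ * ‖b j‖ * (c * ‖a i‖ * ‖b j‖) := by gcongr; exact hab i j
        _ = c * (‖a i‖ ^ 2 * ‖b j‖ ^ 2) := by ring
    refine (norm_sum_le _ _).trans ((Finset.sum_le_sum fun x _ => hterm x.1 x.2).trans ?_)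
    rw [← Finset.mul_sum, Fintype.sum_prod_type]
    simp only [← Finset.mul_sum, hnb, mul_one, hna, le_refl]

end MaassenUffink

/-- The Maassen–Uffink inequality for two projective measurements `P`, `Q` with
`P i * Q j * P i = c² • P i` on a density matrix `S`. -/
theorem maassen_uffink_projective {I ι κ : Type*} [Fintype I] [DecidableEq I] [Fintype ι]
    [Fintype κ] [DecidableEq ι] [DecidableEq κ]
    {S : Matrix I I ℂ} (hS : S.PosSemidef) (hS1 : S.trace = 1)
    {P : ι → Matrix I I ℂ} {Q : κ → Matrix I I ℂ} {c : ℝ} (hc : 0 < c)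
    (hPh : ∀ i, (P i)ᴴ = P i) (hQh : ∀ j, (Q j)ᴴ = Q j)
    (hP : ∀ i j, P i * P j = if i = j then P i else 0)
    (hQ : ∀ i j, Q i * Q j = if i = j then Q i else 0)
    (hPs : ∑ i, P i = 1) (hQs : ∑ j, Q j = 1)
    (hPQ : ∀ i j, P i * Q j * P i = ((c ^ 2 : ℝ) : ℂ) • P i) :
    ∑ i, (S * P i).trace.re * Real.log (S * P i).trace.re +
      ∑ j, (S * Q j).trace.re * Real.log (S * Q j).trace.re ≤ 2 * Real.log c := by
  let _ : SeminormedAddCommGroup (Matrix I I ℂ) := S.toMatrixSeminormedAddCommGroup hS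
  let _ : InnerProductSpace ℂ (Matrix I I ℂ) := S.toMatrixInnerProductSpace hS
  have hinner : ∀ x y : Matrix I I ℂ, inner ℂ x y = (y * S * xᴴ).trace := fun _ _ => rfl
  have hnorm : ∀ x : Matrix I I ℂ, ‖x‖ ^ 2 = (x * S * xᴴ).trace.re := fun x => by
    rw [← inner_self_eq_norm_sq (𝕜 := ℂ), hinner]; rfl
  have hnP : ∀ i, ‖P i‖ ^ 2 = (S * P i).trace.re := fun i => by
    rw [hnorm, hPh, Matrix.mul_assoc, Matrix.trace_mul_comm, Matrix.mul_assoc, hP, if_pos rfl]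
  have hnQ : ∀ i, ‖Q i‖ ^ 2 = (S * Q i).trace.re := fun i => by
    rw [hnorm, hQh, Matrix.mul_assoc, Matrix.trace_mul_comm, Matrix.mul_assoc, hQ, if_pos rfl]
  have key := maassen_uffink (a := P) (b := Q) (ψ := 1) hc ?_ ?_ hPs hQs ?_ ?_
  · have hlog : ∀ x : Matrix I I ℂ, ‖x‖ ^ 2 * Real.log (‖x‖ ^ 2) =
        2 * (‖x‖ ^ 2 * Real.log ‖x‖) := fun x => by
      rw [Real.log_pow]; push_cast; ring
    simp only [← hnP, ← hnQ, hlog, ← Finset.mul_sum, ← mul_add]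
    gcongr
  · intro i j hij
    rw [hinner, hPh, Matrix.trace_mul_comm, ← Matrix.mul_assoc, hP, if_neg hij, Matrix.zero_mul,
      Matrix.trace_zero]
  · intro i j hij
    rw [hinner, hQh, Matrix.trace_mul_comm, ← Matrix.mul_assoc, hQ, if_neg hij, Matrix.zero_mul,
      Matrix.trace_zero]
  · rw [← pow_left_inj₀ (norm_nonneg _) zero_le_one two_ne_zero, hnorm]
    simp [hS1]
  · intro i j
    have h1 : inner ℂ (P i) (Q j) = inner ℂ (Q j * P i) (Q j) := by
      rw [hinner, hinner, conjTranspose_mul, hPh, hQh, ← Matrix.mul_assoc (Q j * S),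
        Matrix.trace_mul_comm (Q j * S * P i), ← Matrix.mul_assoc, ← Matrix.mul_assoc, hQ,
        if_pos rfl]
    have h2 : ‖Q j * P i‖ = c * ‖P i‖ := by
      rw [← pow_left_inj₀ (norm_nonneg _) (by positivity) two_ne_zero, mul_pow, hnP, hnorm,
        conjTranspose_mul, hPh, hQh, Matrix.mul_assoc, Matrix.trace_mul_comm]
      have : S * (P i * Q j) * (Q j * P i) = S * (P i * (Q j * Q j) * P i) := by
        simp only [Matrix.mul_assoc]
      rw [this, hQ, if_pos rfl, hPQ, Matrix.mul_smul, Matrix.trace_smul, smul_eq_mul,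
        Complex.re_ofReal_mul]
    rw [h1, ← h2]
    exact norm_inner_le_norm _ _

section Embeddings

variable {d : ℕ}

lemma embAC_mul (M N : Matrix (Fin d × Fin d) (Fin d × Fin d) ℂ) :
    embAC M * embAC N = embAC (M * N) := by
  ext ⟨a, b, c⟩ ⟨a', b', c'⟩
  simp only [embAC, Matrix.mul_apply, Matrix.of_apply, Fintype.sum_prod_type, Finset.sum_mul]
  refine Finset.sum_congr rfl fun x _ => ?_
  rw [Finset.sum_comm]
  refine Finset.sum_congr rfl fun z _ => ?_
  rw [Finset.sum_eq_single b]
  · simp only [if_true, mul_one, mul_assoc]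
  · intro y _ hy; simp [hy.symm]
  · simp

lemma embBC_mul (M N : Matrix (Fin d × Fin d) (Fin d × Fin d) ℂ) :
    embBC M * embBC N = embBC (M * N) := by
  ext ⟨a, b, c⟩ ⟨a', b', c'⟩
  simp only [embBC, Matrix.mul_apply, Matrix.of_apply, Fintype.sum_prod_type, Finset.sum_mul]
  rw [Finset.sum_eq_single a]
  · simp only [if_true, mul_one, mul_assoc]
  · intro y _ hy; simp [hy.symm]
  · simp

lemma embAC_conjTranspose (M : Matrix (Fin d × Fin d) (Fin d × Fin d) ℂ) :
    (embAC M)ᴴ = embAC Mᴴ := by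
  ext ⟨a, b, c⟩ ⟨a', b', c'⟩
  by_cases h : b = b' <;> simp [embAC, h, eq_comm]

lemma embBC_conjTranspose (M : Matrix (Fin d × Fin d) (Fin d × Fin d) ℂ) :
    (embBC M)ᴴ = embBC Mᴴ := by
  ext ⟨a, b, c⟩ ⟨a', b', c'⟩
  by_cases h : a = a' <;> simp [embBC, h, eq_comm]

lemma embAC_zero : embAC (0 : Matrix (Fin d × Fin d) (Fin d × Fin d) ℂ) = 0 := by
  ext; simp [embAC]

lemma embBC_zero : embBC (0 : Matrix (Fin d × Fin d) (Fin d × Fin d) ℂ) = 0 := by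
  ext; simp [embBC]

lemma embAC_one : embAC (1 : Matrix (Fin d × Fin d) (Fin d × Fin d) ℂ) = 1 := by
  ext ⟨a, b, c⟩ ⟨a', b', c'⟩
  by_cases h : a = a' <;> by_cases h' : b = b' <;> by_cases h'' : c = c' <;>
    simp [embAC, Matrix.one_apply, h, h', h'']

lemma embBC_one : embBC (1 : Matrix (Fin d × Fin d) (Fin d × Fin d) ℂ) = 1 := by
  ext ⟨a, b, c⟩ ⟨a', b', c'⟩
  by_cases h : a = a' <;> by_cases h' : b = b' <;> by_cases h'' : c = c' <;>
    simp [embBC, Matrix.one_apply, h, h', h'']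

lemma embAC_sum {ι : Type*} (s : Finset ι)
    (M : ι → Matrix (Fin d × Fin d) (Fin d × Fin d) ℂ) :
    ∑ i ∈ s, embAC (M i) = embAC (∑ i ∈ s, M i) := by
  ext
  simp only [Matrix.sum_apply, embAC, Matrix.of_apply, Finset.sum_mul]

lemma embBC_sum {ι : Type*} (s : Finset ι)
    (M : ι → Matrix (Fin d × Fin d) (Fin d × Fin d) ℂ) :
    ∑ i ∈ s, embBC (M i) = embBC (∑ i ∈ s, M i) := by
  ext
  simp only [Matrix.sum_apply, embBC, Matrix.of_apply, Finset.sum_mul]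

end Embeddings

section Bases

variable {d : ℕ}

lemma projMat_conjTranspose (φ : Fin d × Fin d → ℂ) : (projMat φ)ᴴ = projMat φ := by
  ext x y
  simp [projMat, mul_comm]

lemma projMat_mul {Φ : Fin (d * d) → Fin d × Fin d → ℂ}
    (hΦ : ∀ i j, ∑ x, (starRingEnd ℂ) (Φ i x) * Φ j x = if i = j then (1 : ℂ) else 0)
    (i j : Fin (d * d)) :
    projMat (Φ i) * projMat (Φ j) = if i = j then projMat (Φ i) else 0 := by
  ext x y
  have : (projMat (Φ i) * projMat (Φ j)) x y =
      Φ i x * (∑ z, (starRingEnd ℂ) (Φ i z) * Φ j z) * (starRingEnd ℂ) (Φ j y) := by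
    simp only [projMat, Matrix.mul_apply, Matrix.of_apply, Finset.mul_sum, Finset.sum_mul,
      mul_assoc]
  rw [this, hΦ]
  split_ifs with h
  · subst h; simp [projMat]
  · simp

lemma sum_projMat {Φ : Fin (d * d) → Fin d × Fin d → ℂ}
    (hΦ : ∀ i j, ∑ x, (starRingEnd ℂ) (Φ i x) * Φ j x = if i = j then (1 : ℂ) else 0) :
    ∑ i, projMat (Φ i) = 1 := by
  let W : Matrix (Fin d × Fin d) (Fin (d * d)) ℂ := Matrix.of fun x i => Φ i x
  have h1 : Wᴴ * W = 1 := by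
    ext i j
    simpa [W, Matrix.mul_apply, Matrix.one_apply] using hΦ i j
  have h2 : W * Wᴴ = 1 :=
    (Matrix.mul_eq_one_comm_of_card_eq _ _ _ (by simp)).1 h1
  rw [← h2]
  ext x y
  simp [W, Matrix.mul_apply, Matrix.sum_apply, projMat]

/-- Pinching the projection onto a maximally entangled vector of BC by that onto a maximally
entangled vector of AC. -/
lemma embAC_mul_embBC_mul_embAC {φ ψ : Fin d × Fin d → ℂ}
    (hφ : ∀ c c', ∑ a, φ (a, c) * (starRingEnd ℂ) (φ (a, c')) = if c = c' then (1 : ℂ) / d else 0)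
    (hψ : ∀ b b', ∑ c, ψ (b, c) * (starRingEnd ℂ) (ψ (b', c)) = if b = b' then (1 : ℂ) / d else 0) :
    embAC (projMat φ) * embBC (projMat ψ) * embAC (projMat φ) =
      ((((1 : ℝ) / d) ^ 2 : ℝ) : ℂ) • embAC (projMat φ) := by
  ext ⟨a, b, c⟩ ⟨a', b', c'⟩
  have hL : (embAC (projMat φ) * embBC (projMat ψ) * embAC (projMat φ)) (a, b, c) (a', b', c') =
      φ (a, c) * (starRingEnd ℂ) (φ (a', c')) * ∑ z, ∑ y,
        (ψ (b, y) * (starRingEnd ℂ) (ψ (b', z))) *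
          ∑ x, φ (x, z) * (starRingEnd ℂ) (φ (x, y)) := by
    simp only [embAC, embBC, projMat, Matrix.mul_apply, Matrix.of_apply, Fintype.sum_prod_type,
      mul_ite, ite_mul, mul_one, mul_zero, zero_mul, Finset.sum_ite_eq, Finset.sum_ite_eq',
      Finset.sum_ite_irrel, Finset.sum_const_zero, Finset.mem_univ, if_true, Finset.sum_mul,
      Finset.mul_sum]
    rw [Finset.sum_comm]
    refine Finset.sum_congr rfl fun z _ => ?_
    rw [Finset.sum_comm]
    exact Finset.sum_congr rfl fun y _ => Finset.sum_congr rfl fun x _ => by ring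
  rw [hL]
  simp only [hφ, mul_ite, mul_zero, Finset.sum_ite_eq, Finset.mem_univ, if_true, ← Finset.sum_mul,
    hψ]
  by_cases h : b = b'
  · simp [embAC, projMat, h]; ring
  · simp [embAC, projMat, h]

/-- Local unitaries act on a bipartite vector, seen as a matrix, by `M ↦ U M Vᵀ`. -/
lemma of_kronVec (U V : Matrix (Fin d) (Fin d) ℂ) (φ : Fin d × Fin d → ℂ) :
    (Matrix.of fun a b => kronVec U V φ (a, b)) = U * (Matrix.of fun a b => φ (a, b)) * Vᵀ := by
  ext a b
  simp only [kronVec, Matrix.of_apply, Matrix.mul_apply, Fintype.sum_prod_type, Finset.sum_mul,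
    Matrix.transpose_apply]
  rw [Finset.sum_comm]
  exact Finset.sum_congr rfl fun _ _ => Finset.sum_congr rfl fun _ _ => by ring

lemma sum_conj_mul_eq_trace (φ ψ : Fin d × Fin d → ℂ) :
    ∑ x, (starRingEnd ℂ) (φ x) * ψ x =
      ((Matrix.of fun a b => φ (a, b))ᴴ * (Matrix.of fun a b => ψ (a, b))).trace := by
  simp only [Matrix.trace, Matrix.diag_apply, Matrix.mul_apply, Matrix.conjTranspose_apply,
    Matrix.of_apply, Fintype.sum_prod_type_right]
  rfl

variable {U V : Matrix (Fin d) (Fin d) ℂ}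

lemma transpose_mul_conjTranspose_transpose (hV : V ∈ Matrix.unitaryGroup (Fin d) ℂ) :
    Vᵀ * Vᵀᴴ = 1 := by
  have h : Vᵀᴴ = Vᴴᵀ := rfl
  have hV' : Vᴴ * V = 1 := (Matrix.mem_unitaryGroup_iff').1 hV
  rw [h, ← Matrix.transpose_mul, hV', Matrix.transpose_one]

lemma sum_conj_kronVec_mul_kronVec (hU : U ∈ Matrix.unitaryGroup (Fin d) ℂ)
    (hV : V ∈ Matrix.unitaryGroup (Fin d) ℂ) (φ ψ : Fin d × Fin d → ℂ) :
    ∑ x, (starRingEnd ℂ) (kronVec U V φ x) * kronVec U V ψ x =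
      ∑ x, (starRingEnd ℂ) (φ x) * ψ x := by
  have hU' : Uᴴ * U = 1 := (Matrix.mem_unitaryGroup_iff').1 hU
  rw [sum_conj_mul_eq_trace, sum_conj_mul_eq_trace, of_kronVec, of_kronVec]
  generalize (Matrix.of fun a b => φ (a, b)) = M
  generalize (Matrix.of fun a b => ψ (a, b)) = N
  rw [conjTranspose_mul, conjTranspose_mul, Matrix.mul_assoc, Matrix.trace_mul_comm]
  have : Mᴴ * Uᴴ * (U * N * Vᵀ) * Vᵀᴴ = Mᴴ * (Uᴴ * U) * N * (Vᵀ * Vᵀᴴ) := by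
    simp only [Matrix.mul_assoc]
  rw [this, hU', transpose_mul_conjTranspose_transpose hV, Matrix.mul_one, Matrix.mul_one]

lemma sum_kronVec_mul_conj_right (hU : U ∈ Matrix.unitaryGroup (Fin d) ℂ)
    (hV : V ∈ Matrix.unitaryGroup (Fin d) ℂ) {φ : Fin d × Fin d → ℂ}
    (hφ : ∀ a a', ∑ b, φ (a, b) * (starRingEnd ℂ) (φ (a', b)) = if a = a' then (1 : ℂ) / d else 0)
    (a a' : Fin d) :
    ∑ b, kronVec U V φ (a, b) * (starRingEnd ℂ) (kronVec U V φ (a', b)) =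
      if a = a' then (1 : ℂ) / d else 0 := by
  have hU' : U * Uᴴ = 1 := (Matrix.mem_unitaryGroup_iff).1 hU
  have hM : (Matrix.of fun a b => φ (a, b)) * (Matrix.of fun a b => φ (a, b))ᴴ =
      ((1 : ℂ) / d) • 1 := by
    ext a a'
    simpa [Matrix.mul_apply, Matrix.one_apply] using hφ a a'
  have hN : (Matrix.of fun a b => kronVec U V φ (a, b)) *
      (Matrix.of fun a b => kronVec U V φ (a, b))ᴴ = ((1 : ℂ) / d) • 1 := by
    rw [of_kronVec]
    generalize (Matrix.of fun a b => φ (a, b)) = M at hM ⊢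
    have : U * M * Vᵀ * (U * M * Vᵀ)ᴴ = U * (M * (Vᵀ * Vᵀᴴ) * Mᴴ) * Uᴴ := by
      simp only [conjTranspose_mul, Matrix.mul_assoc]
    rw [this, transpose_mul_conjTranspose_transpose hV, Matrix.mul_one, hM,
      Matrix.mul_smul, Matrix.smul_mul, Matrix.mul_one, hU']
  simpa [Matrix.mul_apply, Matrix.one_apply] using congrFun (congrFun hN a) a'

lemma kronVec_swap (φ : Fin d × Fin d → ℂ) (a b : Fin d) :
    kronVec U V φ (a, b) = kronVec V U (fun x => φ x.swap) (b, a) := by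
  simp only [kronVec, Fintype.sum_prod_type, Prod.swap_prod_mk]
  rw [Finset.sum_comm]
  exact Finset.sum_congr rfl fun _ _ => Finset.sum_congr rfl fun _ _ => by ring

lemma sum_kronVec_mul_conj_left (hU : U ∈ Matrix.unitaryGroup (Fin d) ℂ)
    (hV : V ∈ Matrix.unitaryGroup (Fin d) ℂ) {φ : Fin d × Fin d → ℂ}
    (hφ : ∀ b b', ∑ a, φ (a, b) * (starRingEnd ℂ) (φ (a, b')) = if b = b' then (1 : ℂ) / d else 0)
    (b b' : Fin d) :
    ∑ a, kronVec U V φ (a, b) * (starRingEnd ℂ) (kronVec U V φ (a, b')) =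
      if b = b' then (1 : ℂ) / d else 0 := by
  simp only [kronVec_swap φ]
  exact sum_kronVec_mul_conj_right hV hU (fun _ _ => hφ _ _) b b'

end Bases

lemma IsProcessComb.trace_eq {dA dB dC : ℕ} {J : PMat dA dB dC} (hJ : IsProcessComb J) :
    J.trace = dB := by
  obtain ⟨-, ρ, -, hρ, h⟩ := hJ
  have h1 : J.trace = (trC J).trace := by
    simp [Matrix.trace, trC, Fintype.sum_prod_type]
  have h2 : (trC J).trace = dB * ρ.trace := by
    rw [h]
    simp [Matrix.trace, Fintype.sum_prod_type, Finset.mul_sum]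
  rw [h1, h2, hρ, mul_one]

lemma H2_eq_neg_sum_div_log_two {n : ℕ} (p : Fin n → ℝ) :
    H2 p = -(∑ i, p i * Real.log (p i)) / Real.log 2 := by
  simp only [H2, Real.logb, neg_div, Finset.sum_div, mul_div_assoc]

/-- causal uncertainty relation: for every process comb `J` on three
`d`-level systems, all unitaries `U₁, U₂, U₃, U₄` and every maximally entangled
orthonormal basis, the common-cause and direct-cause indicator distributions satisfy
`H(p) + H(q) ≥ 2 log₂ d`. -/
theorem causal_uncertainty_relation {d : ℕ} (hd : 2 ≤ d)
    (Φ : Fin (d * d) → Fin d × Fin d → ℂ) (hΦ : IsMaxEntBasis Φ)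
    (U₁ U₂ U₃ U₄ : Matrix (Fin d) (Fin d) ℂ)
    (hU₁ : U₁ ∈ Matrix.unitaryGroup (Fin d) ℂ)
    (hU₂ : U₂ ∈ Matrix.unitaryGroup (Fin d) ℂ)
    (hU₃ : U₃ ∈ Matrix.unitaryGroup (Fin d) ℂ)
    (hU₄ : U₄ ∈ Matrix.unitaryGroup (Fin d) ℂ)
    (J : PMat d d d) (hJ : IsProcessComb J) :
    2 * Real.logb 2 d ≤ H2 (ccProb U₁ U₂ Φ J) + H2 (dcProb U₃ U₄ Φ J) := by
  have hd0 : (0 : ℝ) < d := by exact_mod_cast (by omega : 0 < d)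
  have hdC : (d : ℂ) ≠ 0 := by exact_mod_cast hd0.ne'
  obtain ⟨horth, hright, hleft, -⟩ := hΦ
  have ho₁ : ∀ i j, ∑ x, (starRingEnd ℂ) (kronVec U₁ U₂ (Φ i) x) * kronVec U₁ U₂ (Φ j) x =
      if i = j then (1 : ℂ) else 0 := fun i j => by
    rw [sum_conj_kronVec_mul_kronVec hU₁ hU₂, horth]
  have ho₂ : ∀ i j, ∑ x, (starRingEnd ℂ) (kronVec U₃ U₄ (Φ i) x) * kronVec U₃ U₄ (Φ j) x =
      if i = j then (1 : ℂ) else 0 := fun i j => by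
    rw [sum_conj_kronVec_mul_kronVec hU₃ hU₄, horth]
  have hS : (((1 / d : ℝ) : ℂ) • J).PosSemidef :=
    hJ.1.smul (by exact_mod_cast (one_div_pos.2 hd0).le)
  have hS1 : (((1 / d : ℝ) : ℂ) • J).trace = 1 := by
    rw [Matrix.trace_smul, hJ.trace_eq]
    simp [hdC]
  have key := maassen_uffink_projective hS hS1
    (P := fun i => embAC (projMat (kronVec U₁ U₂ (Φ i))))
    (Q := fun j => embBC (projMat (kronVec U₃ U₄ (Φ j)))) (one_div_pos.2 hd0)
    (fun i => by rw [embAC_conjTranspose, projMat_conjTranspose])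
    (fun j => by rw [embBC_conjTranspose, projMat_conjTranspose])
    (fun i j => by rw [embAC_mul, projMat_mul ho₁, apply_ite embAC, embAC_zero])
    (fun i j => by rw [embBC_mul, projMat_mul ho₂, apply_ite embBC, embBC_zero])
    (by rw [embAC_sum, sum_projMat ho₁, embAC_one])
    (by rw [embBC_sum, sum_projMat ho₂, embBC_one])
    (fun i j => embAC_mul_embBC_mul_embAC
      (sum_kronVec_mul_conj_left hU₁ hU₂ (hleft i)) (sum_kronVec_mul_conj_right hU₃ hU₄ (hright j)))
  simp only [Matrix.smul_mul, Matrix.trace_smul, smul_eq_mul, Complex.re_ofReal_mul] at key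
  rw [H2_eq_neg_sum_div_log_two, H2_eq_neg_sum_div_log_two, ← add_div, Real.logb, ← mul_div_assoc]
  have hlog2 : 0 < Real.log 2 := Real.log_pos one_lt_two
  gcongr
  simp only [ccProb, dcProb, prob]
  rw [one_div (d : ℝ), Real.log_inv, ← one_div] at key
  linarith
end
end
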